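/- Let α ∈ (0,1), let a be an integer, let κ be a positive integer, let y : ℤ → ℝ^κ, and let P be a symmetric positive definite real κ×κ matrix. Then for every integer k ≥ a, ᴳ∇ᵃ_k^α (j ↦ y(j)ᵀ P y(j)) ≤ 2 · y(k)ᵀ P (ᴳ∇ᵃ_k^α y), where the fractional difference of the vector-valued function y is taken componentwise. -/

import Mathlib

open Matrix

noncomputable def nablaGL (α : ℝ) (a : ℤ) (f : ℤ → ℝ) (k : ℤ) : ℝ :=
  ∑ j ∈ Finset.Icc (0 : ℤ) (k - a),
    Real.Gamma ((j : ℝ) - α) / (Real.Gamma (-α) * Real.Gamma ((j : ℝ) + 1)) * f (k - j)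

/-- The Grünwald–Letnikov weight of order `α` at `n`. -/
noncomputable def glWeight (α : ℝ) (n : ℕ) : ℝ :=
  Real.Gamma ((n : ℝ) - α) / (Real.Gamma (-α) * Real.Gamma ((n : ℝ) + 1))

lemma nablaGL_add_natCast (α : ℝ) (a : ℤ) (f : ℤ → ℝ) (n : ℕ) :
    nablaGL α a f (a + n) = ∑ j ∈ Finset.range (n + 1), glWeight α j * f (a + n - j) := by
  unfold nablaGL glWeight
  symm
  refine Finset.sum_bij (fun j _ => (j : ℤ)) ?_ ?_ ?_ ?_
  · intro j hj
    simp only [Finset.mem_range, Finset.mem_Icc] at hj ⊢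
    omega
  · intro i _ j _ h
    exact_mod_cast h
  · intro b hb
    simp only [Finset.mem_range, Finset.mem_Icc] at hb ⊢
    exact ⟨b.toNat, by omega, by omega⟩
  · intro j _
    simp

lemma gamma_one_sub {α : ℝ} (hα0 : 0 < α) : Real.Gamma (1 - α) = -α * Real.Gamma (-α) := by
  rw [← Real.Gamma_add_one (by linarith : -α ≠ 0)]
  ring_nf

lemma gamma_neg_lt_zero {α : ℝ} (hα0 : 0 < α) (hα1 : α < 1) : Real.Gamma (-α) < 0 := by
  have h := gamma_one_sub hα0
  have hpos : 0 < Real.Gamma (1 - α) := Real.Gamma_pos_of_pos (by linarith)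
  nlinarith

lemma glWeight_succ_nonpos {α : ℝ} (hα0 : 0 < α) (hα1 : α < 1) (n : ℕ) :
    glWeight α (n + 1) ≤ 0 := by
  have hn : (0 : ℝ) ≤ n := n.cast_nonneg
  refine div_nonpos_of_nonneg_of_nonpos (Real.Gamma_pos_of_pos ?_).le
    (mul_nonpos_of_nonpos_of_nonneg (gamma_neg_lt_zero hα0 hα1).le
      (Real.Gamma_pos_of_pos ?_).le) <;> push_cast <;> linarith

lemma glWeight_zero {α : ℝ} (hα0 : 0 < α) (hα1 : α < 1) : glWeight α 0 = 1 := by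
  simp [glWeight, (gamma_neg_lt_zero hα0 hα1).ne]

lemma sum_glWeight {α : ℝ} (hα0 : 0 < α) (hα1 : α < 1) (n : ℕ) :
    ∑ j ∈ Finset.range (n + 1), glWeight α j =
      Real.Gamma (n + 1 - α) / (Real.Gamma (1 - α) * Real.Gamma (n + 1)) := by
  have hne := (gamma_neg_lt_zero hα0 hα1).ne
  induction n with
  | zero =>
    have : Real.Gamma (1 - α) ≠ 0 := (Real.Gamma_pos_of_pos (by linarith)).ne'
    simp [glWeight_zero hα0 hα1, this]
  | succ n ih =>
    have hn : (0 : ℝ) ≤ n := n.cast_nonneg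
    have h₁ : Real.Gamma ((n : ℝ) + 1) ≠ 0 := (Real.Gamma_pos_of_pos (by linarith)).ne'
    have h₂ : Real.Gamma ((n : ℝ) + 1 + 1) = (n + 1) * Real.Gamma (n + 1) :=
      Real.Gamma_add_one (by linarith)
    have h₃ : Real.Gamma ((n : ℝ) + 1 + 1 - α) = (n + 1 - α) * Real.Gamma (n + 1 - α) := by
      rw [← Real.Gamma_add_one (by linarith)]
      ring_nf
    have h₄ : (n : ℝ) + 1 ≠ 0 := by linarith
    rw [Finset.sum_range_succ, ih, glWeight]
    push_cast
    rw [h₂, h₃, gamma_one_sub hα0]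
    field_simp
    ring

lemma sum_glWeight_nonneg {α : ℝ} (hα0 : 0 < α) (hα1 : α < 1) (n : ℕ) :
    0 ≤ ∑ j ∈ Finset.range (n + 1), glWeight α j := by
  have hn : (0 : ℝ) ≤ n := n.cast_nonneg
  rw [sum_glWeight hα0 hα1]
  exact div_nonneg (Real.Gamma_pos_of_pos (by linarith)).le
    (mul_nonneg (Real.Gamma_pos_of_pos (by linarith)).le (Real.Gamma_pos_of_pos (by linarith)).le)

lemma Matrix.IsSymm.dotProduct_mulVec_comm {ι : Type*} [Fintype ι] {P : Matrix ι ι ℝ}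
    (hP : P.IsSymm) (u v : ι → ℝ) : u ⬝ᵥ P.mulVec v = v ⬝ᵥ P.mulVec u := by
  rw [dotProduct_mulVec, ← mulVec_transpose, hP.eq, dotProduct_comm]

theorem nablaG_quadratic (α : ℝ) (hα0 : 0 < α) (hα1 : α < 1) (a : ℤ)
    (κ : ℕ) (hκ : 0 < κ) (y : ℤ → Fin κ → ℝ) (P : Matrix (Fin κ) (Fin κ) ℝ)
    (hPsymm : P.IsSymm) (hP : P.PosDef) (k : ℤ) (hk : a ≤ k) :
    nablaGL α a (fun j => y j ⬝ᵥ P.mulVec (y j)) k ≤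
      2 * (y k ⬝ᵥ P.mulVec (fun i => nablaGL α a (fun j => y j i) k)) := by
  obtain ⟨n, rfl⟩ := Int.le.dest hk
  have hnonneg (v : Fin κ → ℝ) : 0 ≤ v ⬝ᵥ P.mulVec v := by
    simpa using hP.posSemidef.dotProduct_mulVec_nonneg v
  have hvec : (fun i => nablaGL α a (fun j => y j i) (a + n)) =
      ∑ j ∈ Finset.range (n + 1), glWeight α j • y (a + n - j) := by
    ext i
    simp [nablaGL_add_natCast]
  rw [hvec, nablaGL_add_natCast, mulVec_sum, dotProduct_sum, Finset.mul_sum]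
  set u := y (a + n) with hu
  have hterm : ∀ j ∈ Finset.range (n + 1),
      glWeight α j * (u ⬝ᵥ P.mulVec u) ≤
        2 * (u ⬝ᵥ P.mulVec (glWeight α j • y (a + n - j))) -
          glWeight α j * (y (a + n - j) ⬝ᵥ P.mulVec (y (a + n - j))) := by
    intro j _
    rw [mulVec_smul, dotProduct_smul, smul_eq_mul]
    cases j with
    | zero =>
      simp only [Nat.cast_zero, sub_zero, ← hu]
      linarith
    | succ j =>
      have hd := hnonneg (u - y (a + n - (j + 1 : ℕ)))
      rw [mulVec_sub, dotProduct_sub, sub_dotProduct, sub_dotProduct,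
        hPsymm.dotProduct_mulVec_comm (y (a + n - (j + 1 : ℕ))) u] at hd
      have := mul_nonpos_of_nonpos_of_nonneg (glWeight_succ_nonpos hα0 hα1 j) hd
      linarith
  have hsum := Finset.sum_le_sum hterm
  rw [← Finset.sum_mul, Finset.sum_sub_distrib] at hsum
  have := mul_nonneg (sum_glWeight_nonneg hα0 hα1 n) (hnonneg u)
  linarith
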